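/- Let X₁ have distribution function F with E X₁ = 0, E X₁² = 1, β³ = E|X₁|³ < ∞, let f be its characteristic function, f_n(t) = (f(t/√n))ⁿ, ℓ = β³/√n and ℓ_n = ℓ + 1/√n. Then for every n ≥ 1 and every t ∈ ℝ: |f_n(t) − e^{−t²/2}| ≤ ℓ e^{−t²/2} ∫₀^{|t|} (u²/2) e^{u²/2} exp{−((n−1)/n) · χ(u, ℓ_n)} du, where χ(t,ε) = t²/2 − κ ε |t|³ for |t| ≤ θ₀/ε, χ(t,ε) = (1 − cos(εt))/ε² for θ₀ < ε|t| ≤ 2π, and χ(t,ε) = 0 for |t| > 2π/ε. -/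

import Mathlib

open MeasureTheory ProbabilityTheory

/-- `κ = sup_{x>0} |cos x − 1 + x²/2| / x³ = 0.09916191…`. -/
noncomputable def kappa : ℝ :=
  ⨆ x : Set.Ioi (0 : ℝ), |Real.cos x - 1 + (x : ℝ) ^ 2 / 2| / (x : ℝ) ^ 3

/-- The Prawitz majorant function `χ(t, ε)`: `χ(t,ε) = t²/2 − κ ε |t|³` for `|t| ≤ θ₀/ε`,
`χ(t,ε) = (1 − cos(εt))/ε²` for `θ₀ < ε|t| ≤ 2π`, and `χ(t,ε) = 0` for `|t| > 2π/ε`. -/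
noncomputable def chi (θ₀ κ t ε : ℝ) : ℝ :=
  if |t| ≤ θ₀ / ε then t ^ 2 / 2 - κ * ε * |t| ^ 3
  else if ε * |t| ≤ 2 * Real.pi then (1 - Real.cos (ε * t)) / ε ^ 2
  else 0

/-- The second derivative of `q x = (1 - cos x) / x ^ 2`, multiplied by `x ^ 4`. -/
noncomputable def cosQuotConvexity (x : ℝ) : ℝ :=
  x ^ 2 * Real.cos x - 4 * x * Real.sin x + 6 * (1 - Real.cos x)

lemma hasDerivAt_cosQuotConvexity (x : ℝ) :
    HasDerivAt cosQuotConvexity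
      (-(x ^ 2 * Real.sin x) - 2 * x * Real.cos x + 2 * Real.sin x) x := by
  have h := ((((hasDerivAt_id x).pow 2).mul (Real.hasDerivAt_cos x)).sub
    (((hasDerivAt_id x).const_mul 4).mul (Real.hasDerivAt_sin x))).add
    (((Real.hasDerivAt_cos x).const_sub 1).const_mul 6)
  refine HasDerivAt.congr_deriv (f := cosQuotConvexity) h ?_
  simp only [id_eq, Pi.pow_apply]
  push_cast
  ring

lemma hasDerivAt_deriv_cosQuotConvexity (x : ℝ) :
    HasDerivAt (fun x : ℝ => -(x ^ 2 * Real.sin x) - 2 * x * Real.cos x + 2 * Real.sin x)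
      (-(x ^ 2 * Real.cos x)) x := by
  have h := ((((hasDerivAt_id x).pow 2).mul (Real.hasDerivAt_sin x)).neg.sub
    (((hasDerivAt_id x).const_mul 2).mul (Real.hasDerivAt_cos x))).add
    ((Real.hasDerivAt_sin x).const_mul 2)
  refine h.congr_deriv ?_
  simp only [id_eq, Pi.pow_apply]
  push_cast
  ring

lemma continuous_cosQuotConvexity : Continuous cosQuotConvexity := by
  unfold cosQuotConvexity
  fun_prop

lemma cosQuotConvexity_nonpos_of_le_pi_div_two {x : ℝ} (h0 : 0 ≤ x) (hx : x ≤ Real.pi / 2) :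
    cosQuotConvexity x ≤ 0 := by
  have hanti : AntitoneOn
      (fun x : ℝ => -(x ^ 2 * Real.sin x) - 2 * x * Real.cos x + 2 * Real.sin x)
      (Set.Icc 0 (Real.pi / 2)) := by
    refine antitoneOn_of_hasDerivWithinAt_nonpos (convex_Icc _ _) (by fun_prop)
      (fun y _ => (hasDerivAt_deriv_cosQuotConvexity y).hasDerivWithinAt) fun y hy => ?_
    rw [interior_Icc] at hy
    have := Real.cos_nonneg_of_mem_Icc (x := y) ⟨by linarith [hy.1, Real.pi_pos], hy.2.le⟩
    have := mul_nonneg (sq_nonneg y) this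
    linarith
  have hanti' : AntitoneOn cosQuotConvexity (Set.Icc 0 (Real.pi / 2)) := by
    refine antitoneOn_of_hasDerivWithinAt_nonpos (convex_Icc _ _)
      continuous_cosQuotConvexity.continuousOn
      (fun y _ => (hasDerivAt_cosQuotConvexity y).hasDerivWithinAt) fun y hy => ?_
    rw [interior_Icc] at hy
    have := hanti ⟨le_rfl, by positivity⟩ ⟨hy.1.le, hy.2.le⟩ hy.1.le
    simpa using this
  have := hanti' ⟨le_rfl, by positivity⟩ ⟨h0, hx⟩ h0
  simpa [cosQuotConvexity] using this

lemma convexOn_cosQuotConvexity :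
    ConvexOn ℝ (Set.Icc (Real.pi / 2) (Real.pi + Real.pi / 2)) cosQuotConvexity := by
  refine convexOn_of_hasDerivWithinAt2_nonneg (convex_Icc _ _)
    continuous_cosQuotConvexity.continuousOn
    (fun y _ => (hasDerivAt_cosQuotConvexity y).hasDerivWithinAt)
    (fun y _ => (hasDerivAt_deriv_cosQuotConvexity y).hasDerivWithinAt) fun y hy => ?_
  rw [interior_Icc] at hy
  have := Real.cos_nonpos_of_pi_div_two_le_of_le hy.1.le hy.2.le
  have := mul_nonpos_of_nonneg_of_nonpos (sq_nonneg y) this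
  linarith

lemma concaveOn_cosQuotConvexity :
    ConcaveOn ℝ (Set.Icc (Real.pi + Real.pi / 2) (2 * Real.pi)) cosQuotConvexity := by
  refine concaveOn_of_hasDerivWithinAt2_nonpos (convex_Icc _ _)
    continuous_cosQuotConvexity.continuousOn
    (fun y _ => (hasDerivAt_cosQuotConvexity y).hasDerivWithinAt)
    (fun y _ => (hasDerivAt_deriv_cosQuotConvexity y).hasDerivWithinAt) fun y hy => ?_
  rw [interior_Icc] at hy
  have h : 0 ≤ Real.cos (y - 2 * Real.pi) :=
    Real.cos_nonneg_of_mem_Icc ⟨by linarith [hy.1], by linarith [hy.2, Real.pi_pos]⟩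
  rw [Real.cos_sub_two_pi] at h
  have := mul_nonneg (sq_nonneg y) h
  linarith

/-- `(1 - cos x) / x ^ 2` has a single inflection point in `(0, 2π)`, and it lies before `π`. -/
lemma exists_inflection_cosQuot :
    ∃ c, 0 < c ∧ c ≤ Real.pi ∧ (∀ x, 0 ≤ x → x ≤ c → cosQuotConvexity x ≤ 0) ∧
      ∀ x, c ≤ x → x ≤ 2 * Real.pi → 0 ≤ cosQuotConvexity x := by
  have hpi := Real.pi_gt_three
  have hpi' := Real.pi_lt_d2
  have hπ : 0 < cosQuotConvexity Real.pi := by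
    simp only [cosQuotConvexity, Real.cos_pi, Real.sin_pi]
    nlinarith
  have hhalf : cosQuotConvexity (Real.pi / 2) < 0 := by
    simp only [cosQuotConvexity, Real.cos_pi_div_two, Real.sin_pi_div_two]
    linarith
  have h32 : 0 ≤ cosQuotConvexity (Real.pi + Real.pi / 2) := by
    simp only [cosQuotConvexity, Real.cos_add, Real.sin_add, Real.cos_pi, Real.sin_pi,
      Real.cos_pi_div_two, Real.sin_pi_div_two]
    nlinarith
  have h2 : 0 ≤ cosQuotConvexity (2 * Real.pi) := by
    simp only [cosQuotConvexity, Real.cos_two_pi, Real.sin_two_pi]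
    nlinarith
  obtain ⟨c, ⟨hc1, hc2⟩, hc⟩ := intermediate_value_Icc (by linarith : Real.pi / 2 ≤ Real.pi)
    continuous_cosQuotConvexity.continuousOn ⟨hhalf.le, hπ.le⟩
  replace hc1 : Real.pi / 2 < c := hc1.lt_of_ne (by rintro rfl; linarith)
  have key : ∀ x, c ≤ x → x ≤ Real.pi + Real.pi / 2 → 0 ≤ cosQuotConvexity x := by
    intro x hx1 hx2
    rcases hx1.eq_or_lt with rfl | hx1
    · exact hc.ge
    have hs := convexOn_cosQuotConvexity.slope_mono_adjacent (x := Real.pi / 2) (y := c) (z := x)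
      ⟨le_rfl, by linarith⟩ ⟨by linarith, hx2⟩ hc1 hx1
    have h := (div_nonneg (by linarith) (by linarith)).trans hs
    rw [le_div_iff₀ (by linarith)] at h
    linarith
  refine ⟨c, by linarith, hc2, fun x h0 hx => ?_, fun x hx hx2 => ?_⟩
  · rcases le_total x (Real.pi / 2) with h | h
    · exact cosQuotConvexity_nonpos_of_le_pi_div_two h0 h
    · have := convexOn_cosQuotConvexity.le_max_of_mem_Icc (x := Real.pi / 2) (y := c) (z := x)
        ⟨le_rfl, by linarith⟩ ⟨hc1.le, by linarith⟩ ⟨h, hx⟩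
      exact this.trans (max_le hhalf.le hc.le)
  · rcases le_total x (Real.pi + Real.pi / 2) with h | h
    · exact key x hx h
    · have := concaveOn_cosQuotConvexity.min_le_of_mem_Icc (x := Real.pi + Real.pi / 2)
        (y := 2 * Real.pi) (z := x) ⟨le_rfl, by linarith⟩ ⟨by linarith, le_rfl⟩ ⟨h, hx2⟩
      exact (le_min h32 h2).trans this

lemma hasDerivAt_cosQuot {x : ℝ} (hx : x ≠ 0) :
    HasDerivAt (fun x : ℝ => (1 - Real.cos x) / x ^ 2)
      ((x * Real.sin x - 2 * (1 - Real.cos x)) / x ^ 3) x := by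
  have h := ((Real.hasDerivAt_cos x).const_sub 1).div (hasDerivAt_pow 2 x) (pow_ne_zero 2 hx)
  refine h.congr_deriv ?_
  field_simp
  push_cast
  ring

lemma hasDerivAt_deriv_cosQuot {x : ℝ} (hx : x ≠ 0) :
    HasDerivAt (fun x : ℝ => (x * Real.sin x - 2 * (1 - Real.cos x)) / x ^ 3)
      (cosQuotConvexity x / x ^ 4) x := by
  have h := (((hasDerivAt_id x).mul (Real.hasDerivAt_sin x)).sub
    (((Real.hasDerivAt_cos x).const_sub 1).const_mul 2)).div (hasDerivAt_pow 3 x)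
    (pow_ne_zero 3 hx)
  refine HasDerivAt.congr_deriv (f := fun x : ℝ => (x * Real.sin x - 2 * (1 - Real.cos x)) / x ^ 3)
    h ?_
  simp only [cosQuotConvexity, id_eq, Pi.mul_apply, Pi.sub_apply]
  field_simp
  push_cast
  ring

lemma half_sinc_sq_eq {x : ℝ} (hx : x ≠ 0) :
    Real.sinc (x / 2) ^ 2 / 2 = (1 - Real.cos x) / x ^ 2 := by
  have h := Real.cos_two_mul' (x / 2)
  have h' := Real.sin_sq_add_cos_sq (x / 2)
  rw [mul_div_cancel₀ x two_ne_zero] at h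
  rw [Real.sinc_of_ne_zero (by positivity), h]
  field_simp
  linarith

/-- The tangent line at `θ` to `(1 - cos x) / x ^ 2` minorizes it on `(0, ∞)`, provided that
`θ ∈ [π, 2π]` and the line does not exceed `1 / 2` at the origin. -/
lemma tangent_le_cosQuot {θ : ℝ} (hθπ : Real.pi ≤ θ) (hθ2 : θ ≤ 2 * Real.pi)
    (hθ : 0 ≤ θ ^ 2 + 2 * θ * Real.sin θ + 6 * (Real.cos θ - 1)) {x : ℝ} (hx : 0 < x) :
    (1 - Real.cos θ) / θ ^ 2 + (θ * Real.sin θ - 2 * (1 - Real.cos θ)) / θ ^ 3 * (x - θ) ≤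
      (1 - Real.cos x) / x ^ 2 := by
  have hpi := Real.pi_pos
  have hθ0 : 0 < θ := by linarith
  obtain ⟨c, hc0, hcπ, hneg, hpos⟩ := exists_inflection_cosQuot
  set m : ℝ := (θ * Real.sin θ - 2 * (1 - Real.cos θ)) / θ ^ 3 with hm
  have hsin : Real.sin θ ≤ 0 := by
    have := Real.sin_nonneg_of_nonneg_of_le_pi (x := 2 * Real.pi - θ) (by linarith) (by linarith)
    rw [Real.sin_two_pi_sub] at this
    linarith
  have hm0 : m ≤ 0 := by
    refine div_nonpos_of_nonpos_of_nonneg ?_ (by positivity)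
    have := mul_nonpos_of_nonneg_of_nonpos hθ0.le hsin
    linarith [Real.cos_le_one θ]
  -- The quotient minus its tangent line is nonnegative on the interval of convexity.
  have hmono : MonotoneOn (fun x : ℝ => (x * Real.sin x - 2 * (1 - Real.cos x)) / x ^ 3)
      (Set.Icc c (2 * Real.pi)) := by
    refine monotoneOn_of_hasDerivWithinAt_nonneg (convex_Icc _ _)
      (fun y hy => (hasDerivAt_deriv_cosQuot (by linarith [hy.1])).continuousAt.continuousWithinAt)
      (fun y hy => (hasDerivAt_deriv_cosQuot
        (by linarith [(interior_subset hy).1])).hasDerivWithinAt) fun y hy => ?_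
    exact div_nonneg (hpos y (interior_subset hy).1 (interior_subset hy).2) (by positivity)
  have hD : ∀ y, 0 < y → HasDerivAt
      (fun x : ℝ => (1 - Real.cos x) / x ^ 2 - ((1 - Real.cos θ) / θ ^ 2 + m * (x - θ)))
      ((y * Real.sin y - 2 * (1 - Real.cos y)) / y ^ 3 - m) y := fun y hy => by
    have h := (hasDerivAt_cosQuot hy.ne').sub
      ((((hasDerivAt_id y).sub_const θ).const_mul m).const_add ((1 - Real.cos θ) / θ ^ 2))
    exact h.congr_deriv (by simp)
  have hcθ : c ≤ θ := by linarith
  have hconv : ∀ y, c ≤ y → y ≤ 2 * Real.pi →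
      (1 - Real.cos θ) / θ ^ 2 + m * (y - θ) ≤ (1 - Real.cos y) / y ^ 2 := by
    intro y hy1 hy2
    rcases le_total y θ with hyθ | hyθ
    · have hanti := antitoneOn_of_hasDerivWithinAt_nonpos (convex_Icc c θ)
        (fun z hz => (hD z (by linarith [hz.1])).continuousAt.continuousWithinAt)
        (fun z hz => (hD z (by linarith [(interior_subset hz).1])).hasDerivWithinAt)
        (fun z hz => sub_nonpos.2 (hmono ⟨(interior_subset hz).1,
          (interior_subset hz).2.trans hθ2⟩ ⟨hcθ, hθ2⟩ (interior_subset hz).2))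
      have := hanti ⟨hy1, hyθ⟩ ⟨hcθ, le_rfl⟩ hyθ
      simp only [sub_self, mul_zero, add_zero] at this
      linarith
    · have hmon := monotoneOn_of_hasDerivWithinAt_nonneg (convex_Icc θ (2 * Real.pi))
        (fun z hz => (hD z (by linarith [hz.1])).continuousAt.continuousWithinAt)
        (fun z hz => (hD z (by linarith [(interior_subset hz).1])).hasDerivWithinAt)
        (fun z hz => sub_nonneg.2 (hmono ⟨hcθ, hθ2⟩ ⟨hcθ.trans (interior_subset hz).1,
          (interior_subset hz).2⟩ (interior_subset hz).1))
      have := hmon ⟨le_rfl, hθ2⟩ ⟨hyθ, hy2⟩ hyθ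
      simp only [sub_self, mul_zero, add_zero] at this
      linarith
  rcases le_total x c with hxc | hxc
  · have hconc : ConcaveOn ℝ (Set.Icc 0 c) (fun x : ℝ => Real.sinc (x / 2) ^ 2 / 2) := by
      have hcongr : ∀ y : ℝ, 0 < y → (fun x : ℝ => (1 - Real.cos x) / x ^ 2) =ᶠ[nhds y]
          fun x : ℝ => Real.sinc (x / 2) ^ 2 / 2 := fun y hy => by
        filter_upwards [lt_mem_nhds hy] with z hz using (half_sinc_sq_eq hz.ne').symm
      have hcont : Continuous fun x : ℝ => Real.sinc (x / 2) ^ 2 / 2 := by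
        have := Real.continuous_sinc
        fun_prop
      refine concaveOn_of_hasDerivWithinAt2_nonpos (convex_Icc _ _) hcont.continuousOn
        (f' := fun x => (x * Real.sin x - 2 * (1 - Real.cos x)) / x ^ 3)
        (f'' := fun x => cosQuotConvexity x / x ^ 4) ?_ ?_ ?_ <;>
      · intro y hy
        rw [interior_Icc] at hy
        first
        | exact ((hasDerivAt_cosQuot hy.1.ne').congr_of_eventuallyEq
            (hcongr y hy.1).symm).hasDerivWithinAt
        | exact (hasDerivAt_deriv_cosQuot hy.1.ne').hasDerivWithinAt
        | exact div_nonpos_of_nonpos_of_nonneg (hneg y hy.1.le hy.2.le) (by positivity)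
    have hline : ConvexOn ℝ (Set.Icc 0 c) (fun x : ℝ => (1 - Real.cos θ) / θ ^ 2 + m * (x - θ)) := by
      refine ⟨convex_Icc _ _, fun y _ z _ a b _ _ hab => le_of_eq ?_⟩
      obtain rfl : b = 1 - a := by linarith
      simp only [smul_eq_mul]
      ring
    have h := (hconc.sub hline).min_le_of_mem_Icc (x := 0) (y := c) (z := x)
      ⟨le_rfl, hc0.le⟩ ⟨hc0.le, le_rfl⟩ ⟨hx.le, hxc⟩
    simp only [Pi.sub_apply] at h
    rw [half_sinc_sq_eq hx.ne', half_sinc_sq_eq hc0.ne'] at h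
    have h1 := hconv c le_rfl (by linarith)
    have h0 : (1 - Real.cos θ) / θ ^ 2 + m * (0 - θ) ≤ 1 / 2 := by
      have e : (1 - Real.cos θ) / θ ^ 2 + m * (0 - θ) =
          (3 * (1 - Real.cos θ) - θ * Real.sin θ) / θ ^ 2 := by
        rw [hm]
        field_simp
        ring
      rw [e, div_le_iff₀ (by positivity)]
      linarith
    rw [zero_div, Real.sinc_zero, one_pow] at h
    exact sub_nonneg.1 ((le_min (sub_nonneg.2 h0) (sub_nonneg.2 h1)).trans h)
  · rcases le_total x (2 * Real.pi) with hx2 | hx2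
    · exact hconv x hxc hx2
    · have h1 := hconv (2 * Real.pi) (by linarith) le_rfl
      rw [Real.cos_two_pi, sub_self, zero_div] at h1
      have h2 : 0 ≤ (1 - Real.cos x) / x ^ 2 :=
        div_nonneg (by linarith [Real.cos_le_one x]) (by positivity)
      have h3 := mul_le_mul_of_nonpos_left (sub_le_sub_right hx2 θ) hm0
      linarith

lemma prawitz_root_function_nonneg {θ₀ θ : ℝ} (h₀ : Real.pi ≤ θ₀) (h : θ₀ ≤ θ)
    (h2 : θ ≤ 2 * Real.pi)
    (hroot : θ₀ ^ 2 + 2 * θ₀ * Real.sin θ₀ + 6 * (Real.cos θ₀ - 1) = 0) :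
    0 ≤ θ ^ 2 + 2 * θ * Real.sin θ + 6 * (Real.cos θ - 1) := by
  have hd : ∀ y : ℝ, HasDerivAt
      (fun x : ℝ => x ^ 2 + 2 * x * Real.sin x + 6 * (Real.cos x - 1))
      (2 * y * (1 + Real.cos y) - 4 * Real.sin y) y := fun y => by
    have h := ((hasDerivAt_pow 2 y).add
      (((hasDerivAt_id y).const_mul 2).mul (Real.hasDerivAt_sin y))).add
      (((Real.hasDerivAt_cos y).sub_const 1).const_mul 6)
    refine HasDerivAt.congr_deriv
      (f := fun x : ℝ => x ^ 2 + 2 * x * Real.sin x + 6 * (Real.cos x - 1)) h ?_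
    simp only [id_eq]
    push_cast
    ring
  have hmono := monotoneOn_of_hasDerivWithinAt_nonneg (convex_Icc Real.pi (2 * Real.pi))
    (fun z _ => (hd z).continuousAt.continuousWithinAt)
    (fun z _ => (hd z).hasDerivWithinAt) (fun z hz => by
      have hz' := interior_subset hz
      have hs := Real.sin_nonneg_of_nonneg_of_le_pi (x := 2 * Real.pi - z)
        (by linarith [hz'.2]) (by linarith [hz'.1])
      rw [Real.sin_two_pi_sub] at hs
      have := mul_nonneg (by linarith [hz'.1, Real.pi_pos] : 0 ≤ 2 * z)
        (by linarith [Real.neg_one_le_cos z] : 0 ≤ 1 + Real.cos z)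
      linarith)
  have := hmono ⟨h₀, h.trans h2⟩ ⟨h₀.trans h, h2⟩ h
  simpa only [hroot] using this

/-- Cubic majorant of the cosine, touching it at `θ`. -/
lemma cos_le_cubic_of_tangent {θ : ℝ} (hθπ : Real.pi ≤ θ) (hθ2 : θ ≤ 2 * Real.pi)
    (hθ : 0 ≤ θ ^ 2 + 2 * θ * Real.sin θ + 6 * (Real.cos θ - 1)) (x : ℝ) :
    Real.cos x ≤ 1 - (3 * (1 - Real.cos θ) - θ * Real.sin θ) / θ ^ 2 * x ^ 2 +
      (2 * (1 - Real.cos θ) - θ * Real.sin θ) / θ ^ 3 * |x| ^ 3 := by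
  rcases eq_or_ne x 0 with rfl | hx
  · simp
  have hθ0 : 0 < θ := Real.pi_pos.trans_le hθπ
  have hx' : 0 < |x| := abs_pos.2 hx
  have h := tangent_le_cosQuot hθπ hθ2 hθ hx'
  rw [Real.cos_abs, le_div_iff₀ (by positivity)] at h
  have e : ((1 - Real.cos θ) / θ ^ 2 +
      (θ * Real.sin θ - 2 * (1 - Real.cos θ)) / θ ^ 3 * (|x| - θ)) * |x| ^ 2 =
      (3 * (1 - Real.cos θ) - θ * Real.sin θ) / θ ^ 2 * |x| ^ 2 -
      (2 * (1 - Real.cos θ) - θ * Real.sin θ) / θ ^ 3 * |x| ^ 3 := by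
    field_simp
    ring
  rw [e, sq_abs] at h
  linarith

lemma bddAbove_kappa : BddAbove (Set.range fun x : Set.Ioi (0 : ℝ) =>
    |Real.cos x - 1 + (x : ℝ) ^ 2 / 2| / (x : ℝ) ^ 3) := by
  refine ⟨1, ?_⟩
  rintro _ ⟨⟨x, hx⟩, rfl⟩
  have hx : 0 < x := hx
  simp only
  rw [div_le_one (by positivity)]
  rcases le_total x 1 with h | h
  · have hb := Real.cos_bound (x := x) (by rwa [abs_of_pos hx])
    rw [abs_of_pos hx] at hb
    have e : Real.cos x - 1 + x ^ 2 / 2 = Real.cos x - (1 - x ^ 2 / 2) := by ring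
    rw [e]
    have : x ^ 4 ≤ x ^ 3 := pow_le_pow_of_le_one hx.le h (by norm_num)
    have : 0 < x ^ 3 := by positivity
    linarith
  · rw [abs_of_nonneg (by linarith [Real.one_sub_sq_div_two_le_cos (x := x)])]
    have : x ^ 2 ≤ x ^ 3 := pow_le_pow_right₀ h (by norm_num)
    nlinarith [Real.cos_le_one x]

lemma kappa_nonneg : 0 ≤ kappa :=
  Real.iSup_nonneg fun x => div_nonneg (abs_nonneg _) (pow_nonneg (le_of_lt x.2) 3)

lemma cos_le_cubic_kappa (x : ℝ) : Real.cos x ≤ 1 - x ^ 2 / 2 + kappa * |x| ^ 3 := by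
  rcases eq_or_ne x 0 with rfl | hx
  · simp
  have hx' : 0 < |x| := abs_pos.2 hx
  have h := le_ciSup bddAbove_kappa ⟨|x|, hx'⟩
  change _ ≤ kappa at h
  simp only [Real.cos_abs, sq_abs] at h
  rw [div_le_iff₀ (by positivity)] at h
  linarith [le_abs_self (Real.cos x - 1 + x ^ 2 / 2)]

lemma norm_cexp_I_mul (s x : ℝ) : ‖Complex.exp (Complex.I * s * x)‖ = 1 := by
  have : Complex.I * s * x = ((s * x : ℝ) : ℂ) * Complex.I := by push_cast; ring
  rw [this, Complex.norm_exp_ofReal_mul_I]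

lemma integrable_mul_cexp_I_mul {μ : Measure ℝ} (hx : Integrable (fun x : ℝ => x) μ) (s : ℝ) :
    Integrable (fun x : ℝ => (x : ℂ) * Complex.exp (Complex.I * s * x)) μ :=
  hx.abs.mono' (by fun_prop) (.of_forall fun x => by
    rw [norm_mul, norm_cexp_I_mul, mul_one, Complex.norm_real, Real.norm_eq_abs])

section CubeIntegrable

variable {μ : Measure ℝ} [IsProbabilityMeasure μ]

lemma integrable_sq_of_integrable_abs_cube (h : Integrable (fun x : ℝ => |x| ^ 3) μ) :
    Integrable (fun x : ℝ => x ^ 2) μ := by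
  refine ((integrable_const 1).add h).mono' (by fun_prop) (.of_forall fun x => ?_)
  rw [Real.norm_of_nonneg (by positivity), ← sq_abs]
  simp only [Pi.add_apply]
  rcases le_total |x| 1 with hx | hx
  · nlinarith [pow_nonneg (abs_nonneg x) 3, abs_nonneg x]
  · linarith [pow_le_pow_right₀ hx (by norm_num : 2 ≤ 3)]

lemma integrable_id_of_integrable_abs_cube (h : Integrable (fun x : ℝ => |x| ^ 3) μ) :
    Integrable (fun x : ℝ => x) μ := by
  refine ((integrable_const 1).add (integrable_sq_of_integrable_abs_cube h)).mono' (by fun_prop)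
    (.of_forall fun x => ?_)
  simp only [Pi.add_apply, Real.norm_eq_abs]
  nlinarith [sq_abs x, sq_nonneg (|x| - 1)]

lemma integrable_mul_abs_of_integrable_abs_cube (h : Integrable (fun x : ℝ => |x| ^ 3) μ) :
    Integrable (fun x : ℝ => x * |x|) μ := by
  refine (integrable_sq_of_integrable_abs_cube h).mono' (by fun_prop) (.of_forall fun x => ?_)
  rw [Real.norm_eq_abs, abs_mul, abs_abs, ← sq, sq_abs]

lemma integral_prod_add_swap {E : Type*} [NormedAddCommGroup E] [NormedSpace ℝ E]
    {T : ℝ × ℝ → E} (hT : Integrable T (μ.prod μ)) :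
    ∫ z, (T z + T z.swap) ∂μ.prod μ = ∫ z, T z ∂μ.prod μ + ∫ z, T z ∂μ.prod μ := by
  have hT' : Integrable (fun z : ℝ × ℝ => T z.swap) (μ.prod μ) := hT.swap
  rw [integral_add hT hT', integral_prod_swap]

lemma integrable_prod_add_swap {E : Type*} [NormedAddCommGroup E]
    {T : ℝ × ℝ → E} (hT : Integrable T (μ.prod μ)) :
    Integrable (fun z => T z + T z.swap) (μ.prod μ) :=
  hT.add hT.swap

lemma integrable_cexp_I_mul (s : ℝ) : Integrable (fun x : ℝ => Complex.exp (Complex.I * s * x)) μ :=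
  (integrable_const (1 : ℝ)).mono' (by fun_prop) (.of_forall fun x => (norm_cexp_I_mul s x).le)

lemma norm_integral_cexp_sq (s : ℝ) :
    ‖∫ x, Complex.exp (Complex.I * s * x) ∂μ‖ ^ 2 =
      ∫ z : ℝ × ℝ, Real.cos (s * (z.1 - z.2)) ∂μ.prod μ := by
  have hconj : (starRingEnd ℂ) (∫ x, Complex.exp (Complex.I * s * x) ∂μ) =
      ∫ x, (starRingEnd ℂ) (Complex.exp (Complex.I * s * x)) ∂μ := integral_conj.symm
  have hmul := integral_prod_mul (μ := μ) (ν := μ)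
    (fun x : ℝ => Complex.exp (Complex.I * s * x))
    (fun x : ℝ => (starRingEnd ℂ) (Complex.exp (Complex.I * s * x)))
  have hint : Integrable (fun z : ℝ × ℝ => Complex.exp (Complex.I * s * z.1) *
      (starRingEnd ℂ) (Complex.exp (Complex.I * s * z.2))) (μ.prod μ) :=
    (integrable_cexp_I_mul s).mul_prod (f := fun x : ℝ => Complex.exp (Complex.I * s * x))
      (g := fun x : ℝ => (starRingEnd ℂ) (Complex.exp (Complex.I * s * x)))
      ((integrable_const (1 : ℝ)).mono' (by fun_prop)
        (.of_forall fun x => by rw [RCLike.norm_conj, norm_cexp_I_mul]))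
  rw [← hconj, Complex.mul_conj'] at hmul
  have hre := congrArg Complex.re hmul
  rw [← Complex.ofReal_pow, Complex.ofReal_re] at hre
  rw [← hre]
  have hre' : (∫ z : ℝ × ℝ, Complex.exp (Complex.I * s * z.1) *
      (starRingEnd ℂ) (Complex.exp (Complex.I * s * z.2)) ∂μ.prod μ).re =
      ∫ z : ℝ × ℝ, (Complex.exp (Complex.I * s * z.1) *
      (starRingEnd ℂ) (Complex.exp (Complex.I * s * z.2))).re ∂μ.prod μ :=
    (integral_re hint).symm
  rw [hre']
  refine integral_congr_ae (.of_forall fun z => ?_)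
  simp only
  rw [← Complex.exp_conj, ← Complex.exp_add]
  have : Complex.I * s * z.1 + (starRingEnd ℂ) (Complex.I * s * z.2) =
      ((s * (z.1 - z.2) : ℝ) : ℂ) * Complex.I := by
    simp only [map_mul, Complex.conj_I, Complex.conj_ofReal]
    push_cast
    ring
  rw [this, Complex.exp_ofReal_mul_I_re]

lemma integral_abs_le_one (hvar : ∫ x, x ^ 2 ∂μ = 1)
    (h3 : Integrable (fun x : ℝ => |x| ^ 3) μ) : ∫ x, |x| ∂μ ≤ 1 := by
  have h2 := integrable_sq_of_integrable_abs_cube h3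
  have h : ∫ x, |x| ∂μ ≤ ∫ x, (1 / 2 + x ^ 2 / 2) ∂μ :=
    integral_mono (integrable_id_of_integrable_abs_cube h3).abs
      ((integrable_const _).add (h2.div_const 2)) fun x => by
        simp only
        nlinarith [sq_abs x, sq_nonneg (|x| - 1)]
  rw [integral_add (integrable_const _) (h2.div_const 2), integral_div (2 : ℝ) (fun x : ℝ => x ^ 2),
    hvar] at h
  simp only [integral_const, probReal_univ, smul_eq_mul] at h
  linarith

/-- The variance of the difference of two independent copies. -/
lemma integral_sub_sq (hmean : ∫ x, x ∂μ = 0) (hvar : ∫ x, x ^ 2 ∂μ = 1)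
    (h3 : Integrable (fun x : ℝ => |x| ^ 3) μ) :
    Integrable (fun z : ℝ × ℝ => (z.1 - z.2) ^ 2) (μ.prod μ) ∧
      ∫ z : ℝ × ℝ, (z.1 - z.2) ^ 2 ∂μ.prod μ = 2 := by
  have h1 := integrable_id_of_integrable_abs_cube h3
  have h2 := integrable_sq_of_integrable_abs_cube h3
  have i1 : Integrable (fun z : ℝ × ℝ => z.1 ^ 2) (μ.prod μ) := h2.comp_fst μ
  have i2 : Integrable (fun z : ℝ × ℝ => z.1 * z.2) (μ.prod μ) := h1.mul_prod h1
  have e : (fun z : ℝ × ℝ => (z.1 - z.2) ^ 2) =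
      fun z => (z.1 ^ 2 - z.1 * z.2) + (z.swap.1 ^ 2 - z.swap.1 * z.swap.2) := by
    ext z
    simp only [Prod.fst_swap, Prod.snd_swap]
    ring
  have v : ∫ z : ℝ × ℝ, (z.1 ^ 2 - z.1 * z.2) ∂μ.prod μ = 1 := by
    rw [integral_sub i1 i2, integral_fun_fst (f := fun x : ℝ => x ^ 2),
      integral_prod_mul (fun x : ℝ => x) (fun x : ℝ => x), hmean, hvar]
    simp
  rw [e]
  refine ⟨integrable_prod_add_swap (i1.sub i2), ?_⟩
  rw [integral_prod_add_swap (T := fun z : ℝ × ℝ => z.1 ^ 2 - z.1 * z.2) (i1.sub i2), v]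
  norm_num

/-- The third absolute moment of the difference of two independent copies. -/
lemma integral_abs_sub_cube_le (hmean : ∫ x, x ∂μ = 0) (hvar : ∫ x, x ^ 2 ∂μ = 1)
    (h3 : Integrable (fun x : ℝ => |x| ^ 3) μ) :
    Integrable (fun z : ℝ × ℝ => |z.1 - z.2| ^ 3) (μ.prod μ) ∧
      ∫ z : ℝ × ℝ, |z.1 - z.2| ^ 3 ∂μ.prod μ ≤ 2 * (∫ x, |x| ^ 3 ∂μ + 1) := by
  have h1 := integrable_id_of_integrable_abs_cube h3
  have h2 := integrable_sq_of_integrable_abs_cube h3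
  have i1 : Integrable (fun z : ℝ × ℝ => |z.1| ^ 3) (μ.prod μ) := h3.comp_fst μ
  have i2 : Integrable (fun z : ℝ × ℝ => z.1 * |z.1| * z.2) (μ.prod μ) :=
    (integrable_mul_abs_of_integrable_abs_cube h3).mul_prod h1
  have i3 : Integrable (fun z : ℝ × ℝ => |z.1| * z.2 ^ 2) (μ.prod μ) := h1.abs.mul_prod h2
  have i12 : Integrable (fun z : ℝ × ℝ => |z.1| ^ 3 - 2 * (z.1 * |z.1| * z.2)) (μ.prod μ) :=
    i1.sub (i2.const_mul 2)
  have iT : Integrable (fun z : ℝ × ℝ => |z.1| ^ 3 - 2 * (z.1 * |z.1| * z.2) + |z.1| * z.2 ^ 2)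
      (μ.prod μ) := i12.add i3
  have hle : ∀ z : ℝ × ℝ, |z.1 - z.2| ^ 3 ≤
      (fun z : ℝ × ℝ => |z.1| ^ 3 - 2 * (z.1 * |z.1| * z.2) + |z.1| * z.2 ^ 2) z +
      (fun z : ℝ × ℝ => |z.1| ^ 3 - 2 * (z.1 * |z.1| * z.2) + |z.1| * z.2 ^ 2) z.swap := by
    rintro ⟨x, y⟩
    have h := mul_le_mul_of_nonneg_left (abs_sub x y) (sq_nonneg (x - y))
    have e : (x - y) ^ 2 * |x - y| = |x - y| ^ 3 := by rw [← sq_abs]; ring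
    rw [e] at h
    refine h.trans_eq ?_
    simp only [Prod.swap_prod_mk]
    have ex : |x| ^ 3 = |x| * x ^ 2 := by rw [← sq_abs x]; ring
    have ey : |y| ^ 3 = |y| * y ^ 2 := by rw [← sq_abs y]; ring
    rw [ex, ey]
    ring
  have hint : Integrable (fun z : ℝ × ℝ => |z.1 - z.2| ^ 3) (μ.prod μ) :=
    (integrable_prod_add_swap iT).mono' (by fun_prop) (.of_forall fun z => by
      rw [Real.norm_of_nonneg (by positivity)]
      exact hle z)
  refine ⟨hint, (integral_mono hint (integrable_prod_add_swap iT) hle).trans ?_⟩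
  rw [integral_prod_add_swap iT, integral_add i12 i3,
    integral_sub i1 (i2.const_mul 2), integral_const_mul,
    integral_fun_fst (f := fun x : ℝ => |x| ^ 3),
    integral_prod_mul (fun x : ℝ => x * |x|) (fun x : ℝ => x),
    integral_prod_mul (fun x : ℝ => |x|) (fun x : ℝ => x ^ 2), hmean, hvar]
  simp only [probReal_univ, one_smul, mul_zero, sub_zero, mul_one]
  linarith [integral_abs_le_one hvar h3]

/-- A cubic majorant of the cosine bounds the modulus of a characteristic function. -/
lemma norm_integral_cexp_sq_le_of_cubic (hmean : ∫ x, x ∂μ = 0) (hvar : ∫ x, x ^ 2 ∂μ = 1)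
    (h3 : Integrable (fun x : ℝ => |x| ^ 3) μ) {a b : ℝ} (hb : 0 ≤ b)
    (hcos : ∀ x : ℝ, Real.cos x ≤ 1 - a * x ^ 2 + b * |x| ^ 3) (s : ℝ) :
    ‖∫ x, Complex.exp (Complex.I * s * x) ∂μ‖ ^ 2 ≤
      1 - 2 * (a * s ^ 2 - b * (∫ x, |x| ^ 3 ∂μ + 1) * |s| ^ 3) := by
  obtain ⟨i2, v2⟩ := integral_sub_sq hmean hvar h3
  obtain ⟨i3, v3⟩ := integral_abs_sub_cube_le hmean hvar h3
  have j2 := i2.const_mul (a * s ^ 2)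
  have j3 := i3.const_mul (b * |s| ^ 3)
  have j12 : Integrable (fun z : ℝ × ℝ => 1 - a * s ^ 2 * (z.1 - z.2) ^ 2) (μ.prod μ) :=
    (integrable_const 1).sub j2
  have ic : Integrable (fun z : ℝ × ℝ => Real.cos (s * (z.1 - z.2))) (μ.prod μ) :=
    (integrable_const (1 : ℝ)).mono' (by fun_prop) (.of_forall fun z => Real.abs_cos_le_one _)
  have hle : ∫ z : ℝ × ℝ, Real.cos (s * (z.1 - z.2)) ∂μ.prod μ ≤
      ∫ z : ℝ × ℝ, (1 - a * s ^ 2 * (z.1 - z.2) ^ 2 + b * |s| ^ 3 * |z.1 - z.2| ^ 3)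
        ∂μ.prod μ := by
    refine integral_mono ic (j12.add j3) fun z => ?_
    refine (hcos _).trans_eq ?_
    simp only [abs_mul, mul_pow]
    ring
  rw [integral_add j12 j3, integral_sub (integrable_const 1) j2,
    integral_const_mul, integral_const_mul, v2] at hle
  simp only [integral_const, probReal_univ, one_smul] at hle
  rw [norm_integral_cexp_sq]
  have := mul_le_mul_of_nonneg_left v3 (by positivity : 0 ≤ b * |s| ^ 3)
  linarith

lemma norm_le_exp_neg_of_sq_le {z : ℂ} {c : ℝ} (h : ‖z‖ ^ 2 ≤ 1 - 2 * c) :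
    ‖z‖ ≤ Real.exp (-c) := by
  refine le_of_sq_le_sq ?_ (Real.exp_pos _).le
  rw [← Real.exp_nat_mul]
  have := Real.add_one_le_exp (((2 : ℕ) : ℝ) * -c)
  push_cast at this ⊢
  linarith

/-- Prawitz's bound for the modulus of a characteristic function. -/
lemma norm_integral_cexp_le_exp_neg_chi (hmean : ∫ x, x ∂μ = 0) (hvar : ∫ x, x ^ 2 ∂μ = 1)
    (h3 : Integrable (fun x : ℝ => |x| ^ 3) μ) {θ₀ : ℝ}
    (hθ₀mem : θ₀ ∈ Set.Icc Real.pi (2 * Real.pi))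
    (hθ₀root : θ₀ ^ 2 + 2 * θ₀ * Real.sin θ₀ + 6 * (Real.cos θ₀ - 1) = 0) (s : ℝ) :
    ‖∫ x, Complex.exp (Complex.I * s * x) ∂μ‖ ≤
      Real.exp (-chi θ₀ kappa s (∫ x, |x| ^ 3 ∂μ + 1)) := by
  have hδ : 0 < ∫ x, |x| ^ 3 ∂μ + 1 := by
    have : 0 ≤ ∫ x, |x| ^ 3 ∂μ := integral_nonneg fun x => by positivity
    linarith
  unfold chi
  split_ifs with h1 h2
  · refine norm_le_exp_neg_of_sq_le ((norm_integral_cexp_sq_le_of_cubic hmean hvar h3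
      (a := 1 / 2) kappa_nonneg (fun x => ?_) s).trans_eq (by ring))
    exact (cos_le_cubic_kappa x).trans_eq (by ring)
  · set δ := ∫ x, |x| ^ 3 ∂μ + 1
    set θ := δ * |s| with hθ
    have hθ₀θ : θ₀ ≤ θ := by
      rw [not_le, div_lt_iff₀ hδ] at h1
      linarith
    have hθπ : Real.pi ≤ θ := hθ₀mem.1.trans hθ₀θ
    have hθ0 : 0 < θ := Real.pi_pos.trans_le hθπ
    have hs0 : 0 < |s| := pos_of_mul_pos_right hθ0 hδ.le
    have hsin : Real.sin θ ≤ 0 := by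
      have := Real.sin_nonneg_of_nonneg_of_le_pi (x := 2 * Real.pi - θ) (by linarith)
        (by linarith)
      rw [Real.sin_two_pi_sub] at this
      linarith
    have hb : 0 ≤ (2 * (1 - Real.cos θ) - θ * Real.sin θ) / θ ^ 3 := by
      refine div_nonneg ?_ (by positivity)
      have := mul_nonpos_of_nonneg_of_nonpos hθ0.le hsin
      linarith [Real.cos_le_one θ]
    refine norm_le_exp_neg_of_sq_le ((norm_integral_cexp_sq_le_of_cubic hmean hvar h3 hb
      (cos_le_cubic_of_tangent hθπ h2
        (prawitz_root_function_nonneg hθ₀mem.1 hθ₀θ h2 hθ₀root)) s).trans_eq ?_)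
    have hcos : Real.cos (δ * s) = Real.cos θ := by
      rw [hθ, ← abs_of_pos hδ, ← abs_mul, Real.cos_abs, abs_of_pos hδ]
    have hδ' : δ = θ / |s| := by rw [hθ]; field_simp
    rw [hcos, ← sq_abs s]
    change 1 - 2 * (_ - _ * δ * _) = _
    clear_value θ
    rw [hδ']
    field_simp
    ring
  · simp only [neg_zero, Real.exp_zero]
    refine (norm_integral_le_of_norm_le_const (C := 1)
      (.of_forall fun x => (norm_cexp_I_mul s x).le)).trans ?_
    simp

lemma hasDerivAt_cexp_I_mul (s x : ℝ) :
    HasDerivAt (fun x : ℝ => Complex.exp (Complex.I * s * x))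
      (Complex.I * s * Complex.exp (Complex.I * s * x)) x := by
  have h := ((Complex.ofRealCLM.hasDerivAt (x := x)).const_mul (Complex.I * s)).cexp
  refine HasDerivAt.congr_deriv (f := fun x : ℝ => Complex.exp (Complex.I * s * x)) h ?_
  simp only [Complex.ofRealCLM_apply, Complex.ofReal_one]
  ring

lemma hasDerivAt_mul_abs_div_two (w : ℝ) :
    HasDerivAt (fun w : ℝ => w * |w| / 2) |w| w := by
  rcases lt_trichotomy w 0 with h | rfl | h
  · have h' : HasDerivAt (fun w : ℝ => -(w ^ 2 / 2)) |w| w := by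
      refine (((hasDerivAt_pow 2 w).div_const 2).neg).congr_deriv ?_
      rw [abs_of_neg h]
      push_cast
      ring
    refine h'.congr_of_eventuallyEq ?_
    filter_upwards [gt_mem_nhds h] with z hz
    rw [abs_of_neg hz]
    ring
  · rw [hasDerivAt_iff_tendsto_slope_zero, abs_zero]
    have : Filter.Tendsto (fun t : ℝ => |t| / 2) (nhdsWithin 0 {0}ᶜ) (nhds 0) := by
      have : Continuous fun t : ℝ => |t| / 2 := by fun_prop
      exact tendsto_nhdsWithin_of_tendsto_nhds (by simpa using this.tendsto 0)
    refine this.congr' ?_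
    filter_upwards [self_mem_nhdsWithin] with t ht
    have ht : t ≠ 0 := ht
    simp only [zero_add, zero_mul, zero_div, sub_zero, smul_eq_mul]
    field_simp
  · have h' : HasDerivAt (fun w : ℝ => w ^ 2 / 2) |w| w := by
      refine ((hasDerivAt_pow 2 w).div_const 2).congr_deriv ?_
      rw [abs_of_pos h]
      push_cast
      ring
    refine h'.congr_of_eventuallyEq ?_
    filter_upwards [lt_mem_nhds h] with z hz
    rw [abs_of_pos hz]
    ring

lemma norm_cexp_two_point_le_of_le (s : ℝ) {x y : ℝ} (hyx : y ≤ x) :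
    ‖Complex.exp (Complex.I * s * x) - Complex.exp (Complex.I * s * y) +
      y * (Complex.I * s * Complex.exp (Complex.I * s * x)) -
      x * (Complex.I * s * Complex.exp (Complex.I * s * y))‖ ≤
      s ^ 2 * ((x * |x| - y * |y|) / 2) := by
  have hφ : ∀ u : ℝ, HasDerivAt (fun u : ℝ => Complex.exp (Complex.I * s * u) +
      ((x + y - u : ℝ) : ℂ) * (Complex.I * s * Complex.exp (Complex.I * s * u)) -
      (Complex.exp (Complex.I * s * y) + x * (Complex.I * s * Complex.exp (Complex.I * s * y))))
      (((x + y - u : ℝ) : ℂ) * ((Complex.I * s) ^ 2 * Complex.exp (Complex.I * s * u))) u := by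
    intro u
    have hw := ((hasDerivAt_id u).const_sub (x + y)).ofReal_comp
    have h := ((hasDerivAt_cexp_I_mul s u).add
      (hw.mul ((hasDerivAt_cexp_I_mul s u).const_mul (Complex.I * s)))).sub_const
      (Complex.exp (Complex.I * s * y) + x * (Complex.I * s * Complex.exp (Complex.I * s * y)))
    refine h.congr_deriv ?_
    simp only [id_eq]
    push_cast
    ring
  have hB : ∀ u : ℝ, HasDerivAt (fun u : ℝ =>
      s ^ 2 * (x * |x| / 2 - (x + y - u) * |x + y - u| / 2)) (s ^ 2 * |x + y - u|) u := by
    intro u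
    have h := (((hasDerivAt_mul_abs_div_two (x + y - u)).comp u
      ((hasDerivAt_id u).const_sub (x + y))).const_sub (x * |x| / 2)).const_mul (s ^ 2)
    exact h.congr_deriv (by ring)
  have key := image_norm_le_of_norm_deriv_right_le_deriv_boundary (a := y) (b := x)
    (fun u _ => (hφ u).continuousAt.continuousWithinAt)
    (fun u _ => (hφ u).hasDerivWithinAt) (by simp) hB (fun u _ => by
      rw [norm_mul, norm_mul, norm_cexp_I_mul, Complex.norm_real, Real.norm_eq_abs, norm_pow,
        norm_mul, Complex.norm_I, Complex.norm_real, Real.norm_eq_abs, one_mul, sq_abs]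
      linarith) (Set.right_mem_Icc.2 hyx)
  refine (le_of_eq ?_).trans (key.trans_eq ?_)
  · congr 1
    push_cast
    ring
  · simp only [add_sub_cancel_left]
    ring

/-- The pointwise inequality behind `norm_integral_deriv_add_le`; its right-hand side has expectation
`s ^ 2 * E|X| ^ 3` for independent centred identically distributed arguments. -/
lemma norm_cexp_two_point_le (s x y : ℝ) :
    ‖((x - y : ℝ) : ℂ) * (Complex.exp (Complex.I * s * x) - Complex.exp (Complex.I * s * y) +
      y * (Complex.I * s * Complex.exp (Complex.I * s * x)) -
      x * (Complex.I * s * Complex.exp (Complex.I * s * y)))‖ ≤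
      s ^ 2 * ((|x| ^ 3 + |y| ^ 3 - x * |x| * y - y * |y| * x) / 2) := by
  have ex : |x| ^ 3 = |x| * x ^ 2 := by rw [← sq_abs x]; ring
  have ey : |y| ^ 3 = |y| * y ^ 2 := by rw [← sq_abs y]; ring
  rw [norm_mul, Complex.norm_real, Real.norm_eq_abs, ex, ey]
  rcases le_total y x with h | h
  · rw [abs_of_nonneg (sub_nonneg.2 h)]
    exact (mul_le_mul_of_nonneg_left (norm_cexp_two_point_le_of_le s h)
      (sub_nonneg.2 h)).trans_eq (by ring)
  · rw [abs_of_nonpos (sub_nonpos.2 h), ← norm_neg]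
    refine (mul_le_mul_of_nonneg_left ((le_of_eq ?_).trans (norm_cexp_two_point_le_of_le s h))
      (neg_nonneg.2 (sub_nonpos.2 h))).trans_eq (by ring)
    congr 1
    ring

/-- If `f` is the characteristic function of a centred law of unit variance and `g` is its
derivative, then `|g(s) + s f(s)| ≤ s ^ 2 / 2 * E|X| ^ 3`. -/
lemma norm_integral_deriv_add_le (hmean : ∫ x, x ∂μ = 0) (hvar : ∫ x, x ^ 2 ∂μ = 1)
    (h3 : Integrable (fun x : ℝ => |x| ^ 3) μ) (s : ℝ) :
    ‖∫ x, Complex.I * (x * Complex.exp (Complex.I * s * x)) ∂μ +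
      s * ∫ x, Complex.exp (Complex.I * s * x) ∂μ‖ ≤ (∫ x, |x| ^ 3 ∂μ) * s ^ 2 / 2 := by
  have h1 := integrable_id_of_integrable_abs_cube h3
  have h2 := integrable_sq_of_integrable_abs_cube h3
  have g0 := integrable_cexp_I_mul (μ := μ) s
  have g1 := integrable_mul_cexp_I_mul h1 s
  have c1 : Integrable (fun x : ℝ => (x : ℂ)) μ := h1.ofReal
  have c2 : Integrable (fun x : ℝ => (x : ℂ) ^ 2) μ :=
    (h2.ofReal (𝕜 := ℂ)).congr (.of_forall fun x => by simp)
  have m1 : ∫ x, (x : ℂ) ∂μ = 0 := by rw [integral_complex_ofReal, hmean, Complex.ofReal_zero]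
  have m2 : ∫ x, (x : ℂ) ^ 2 ∂μ = 1 := by
    simp only [← Complex.ofReal_pow]
    rw [integral_complex_ofReal, hvar, Complex.ofReal_one]
  -- The complex kernel and its integral.
  let T : ℝ × ℝ → ℂ := fun z => z.1 * Complex.exp (Complex.I * s * z.1) -
    z.1 * Complex.exp (Complex.I * s * z.2) +
    Complex.I * s * (z.1 * Complex.exp (Complex.I * s * z.1) * z.2) -
    Complex.I * s * (z.1 ^ 2 * Complex.exp (Complex.I * s * z.2))
  have i1 : Integrable (fun z : ℝ × ℝ => (z.1 : ℂ) * Complex.exp (Complex.I * s * z.1))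
    (μ.prod μ) := g1.comp_fst μ
  have i2 : Integrable (fun z : ℝ × ℝ => (z.1 : ℂ) * Complex.exp (Complex.I * s * z.2))
    (μ.prod μ) := c1.mul_prod g0
  have i3 : Integrable (fun z : ℝ × ℝ => Complex.I * s *
    (z.1 * Complex.exp (Complex.I * s * z.1) * z.2)) (μ.prod μ) := (g1.mul_prod c1).const_mul _
  have i4 : Integrable (fun z : ℝ × ℝ => Complex.I * s *
    ((z.1 : ℂ) ^ 2 * Complex.exp (Complex.I * s * z.2))) (μ.prod μ) := (c2.mul_prod g0).const_mul _
  have i12 : Integrable (fun z : ℝ × ℝ => (z.1 : ℂ) * Complex.exp (Complex.I * s * z.1) -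
    z.1 * Complex.exp (Complex.I * s * z.2)) (μ.prod μ) := i1.sub i2
  have i123 : Integrable (fun z : ℝ × ℝ => (z.1 : ℂ) * Complex.exp (Complex.I * s * z.1) -
    z.1 * Complex.exp (Complex.I * s * z.2) +
    Complex.I * s * (z.1 * Complex.exp (Complex.I * s * z.1) * z.2)) (μ.prod μ) := i12.add i3
  have iT : Integrable T (μ.prod μ) := i123.sub i4
  have vT : ∫ z, T z ∂μ.prod μ = ∫ x, x * Complex.exp (Complex.I * s * x) ∂μ -
      Complex.I * s * ∫ x, Complex.exp (Complex.I * s * x) ∂μ := by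
    simp only [T]
    rw [integral_sub i123 i4, integral_add i12 i3, integral_sub i1 i2, integral_const_mul,
      integral_const_mul,
      integral_fun_fst (f := fun x : ℝ => (x : ℂ) * Complex.exp (Complex.I * s * x)),
      integral_prod_mul (fun x : ℝ => (x : ℂ)) (fun x : ℝ => Complex.exp (Complex.I * s * x)),
      integral_prod_mul (fun x : ℝ => (x : ℂ) * Complex.exp (Complex.I * s * x))
        (fun x : ℝ => (x : ℂ)),
      integral_prod_mul (fun x : ℝ => (x : ℂ) ^ 2) (fun x : ℝ => Complex.exp (Complex.I * s * x)),
      m1, m2]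
    simp
  -- The real majorant and its integral.
  let S : ℝ × ℝ → ℝ := fun z => s ^ 2 / 2 * (|z.1| ^ 3 - z.1 * |z.1| * z.2)
  have j1 : Integrable (fun z : ℝ × ℝ => |z.1| ^ 3) (μ.prod μ) := h3.comp_fst μ
  have j2 : Integrable (fun z : ℝ × ℝ => z.1 * |z.1| * z.2) (μ.prod μ) :=
    (integrable_mul_abs_of_integrable_abs_cube h3).mul_prod h1
  have jS : Integrable S (μ.prod μ) := (j1.sub j2).const_mul _
  have vS : ∫ z, S z ∂μ.prod μ = s ^ 2 / 2 * ∫ x, |x| ^ 3 ∂μ := by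
    simp only [S]
    rw [integral_const_mul, integral_sub j1 j2, integral_fun_fst (f := fun x : ℝ => |x| ^ 3),
      integral_prod_mul (fun x : ℝ => x * |x|) (fun x : ℝ => x), hmean]
    simp
  have hle : ‖∫ z, (T z + T z.swap) ∂μ.prod μ‖ ≤ ∫ z, (S z + S z.swap) ∂μ.prod μ := by
    refine norm_integral_le_of_norm_le (integrable_prod_add_swap jS) (.of_forall ?_)
    rintro ⟨x, y⟩
    refine (le_of_eq ?_).trans ((norm_cexp_two_point_le s x y).trans_eq ?_)
    · simp only [T, Prod.swap_prod_mk]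
      congr 1
      push_cast
      ring
    · simp only [S, Prod.swap_prod_mk]
      ring
  rw [integral_prod_add_swap iT, integral_prod_add_swap jS, vT, vS, ← two_mul, norm_mul,
    Complex.norm_two] at hle
  have e : ∫ x, Complex.I * (x * Complex.exp (Complex.I * s * x)) ∂μ +
      s * ∫ x, Complex.exp (Complex.I * s * x) ∂μ =
      Complex.I * (∫ x, x * Complex.exp (Complex.I * s * x) ∂μ -
      Complex.I * s * ∫ x, Complex.exp (Complex.I * s * x) ∂μ) := by
    rw [integral_const_mul]
    linear_combination (s * ∫ x, Complex.exp (Complex.I * s * x) ∂μ) * Complex.I_sq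
  rw [e, norm_mul, Complex.norm_I, one_mul]
  linarith

lemma hasDerivAt_integral_cexp (hx : Integrable (fun x : ℝ => x) μ) (t : ℝ) :
    HasDerivAt (fun t : ℝ => ∫ x, Complex.exp (Complex.I * t * x) ∂μ)
      (∫ x, Complex.I * (x * Complex.exp (Complex.I * t * x)) ∂μ) t := by
  refine (hasDerivAt_integral_of_dominated_loc_of_deriv_le (s := Set.univ)
    (F' := fun (t : ℝ) (x : ℝ) => Complex.I * (x * Complex.exp (Complex.I * t * x)))
    (bound := fun x => |x|) Filter.univ_mem (.of_forall fun t => by fun_prop)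
    (integrable_cexp_I_mul t) (by fun_prop) (.of_forall fun x t _ => ?_) hx.abs
    (.of_forall fun x t _ => ?_)).2
  · rw [norm_mul, norm_mul, norm_cexp_I_mul, Complex.norm_I, Complex.norm_real, Real.norm_eq_abs,
      one_mul, mul_one]
  · have h := hasDerivAt_cexp_I_mul x t
    have e : ∀ t : ℝ, Complex.I * x * t = Complex.I * t * x := fun t => by ring
    simp only [e] at h
    exact h.congr_deriv (by ring)

end CubeIntegrable

lemma continuous_integral_mul_cexp {μ : Measure ℝ} (hx : Integrable (fun x : ℝ => x) μ) :
    Continuous fun t : ℝ => ∫ x, Complex.I * (x * Complex.exp (Complex.I * t * x)) ∂μ := by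
  refine continuous_of_dominated (bound := fun x => |x|) (fun t => by fun_prop)
    (fun t => .of_forall fun x => ?_) hx.abs (.of_forall fun x => by fun_prop)
  rw [norm_mul, norm_mul, norm_cexp_I_mul, Complex.norm_I, Complex.norm_real, Real.norm_eq_abs,
    one_mul, mul_one]

lemma chi_scale (θ₀ κ s δ : ℝ) {r : ℝ} (hr : 0 < r) :
    chi θ₀ κ s (δ / r) = r ^ 2 * chi θ₀ κ (s / r) δ := by
  have e1 : |s / r| = |s| / r := by rw [abs_div, abs_of_pos hr]
  have e2 : δ / r * |s| = δ * |s / r| := by rw [e1]; ring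
  have e3 : δ / r * s = δ * (s / r) := by ring
  have e4 : (|s| ≤ θ₀ / (δ / r)) ↔ (|s / r| ≤ θ₀ / δ) := by
    rw [e1, div_le_iff₀ hr, div_div_eq_mul_div, div_mul_eq_mul_div]
  unfold chi
  simp only [e2, e3, e4]
  split_ifs
  · rw [e1]
    field_simp
  · field_simp
  · simp

lemma measurable_chi (θ₀ κ ε : ℝ) : Measurable fun u => chi θ₀ κ u ε := by
  unfold chi
  refine Measurable.ite (measurableSet_le (by fun_prop) (by fun_prop)) (by fun_prop)
    (Measurable.ite (measurableSet_le (by fun_prop) (by fun_prop)) (by fun_prop) (by fun_prop))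

lemma neg_chi_le {θ₀ κ ε : ℝ} (hκ : 0 ≤ κ) (hε : 0 ≤ ε) (u : ℝ) :
    -chi θ₀ κ u ε ≤ κ * ε * |u| ^ 3 := by
  have h : 0 ≤ κ * ε * |u| ^ 3 := by positivity
  unfold chi
  split_ifs
  · nlinarith [sq_nonneg u]
  · have : 0 ≤ (1 - Real.cos (ε * u)) / ε ^ 2 :=
      div_nonneg (by linarith [Real.cos_le_one (ε * u)]) (by positivity)
    linarith
  · linarith

lemma intervalIntegrable_exp_neg_chi {θ₀ κ ε c t : ℝ} (hκ : 0 ≤ κ) (hε : 0 ≤ ε) (hc : 0 ≤ c)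
    (ht : 0 ≤ t) :
    IntervalIntegrable (fun u => u ^ 2 / 2 * Real.exp (u ^ 2 / 2) *
      Real.exp (-c * chi θ₀ κ u ε)) volume 0 t := by
  have hm := measurable_chi θ₀ κ ε
  rw [intervalIntegrable_iff_integrableOn_Ioc_of_le ht]
  have hb : Continuous fun u : ℝ =>
      u ^ 2 / 2 * Real.exp (u ^ 2 / 2) * Real.exp (c * (κ * ε * |u| ^ 3)) := by fun_prop
  refine Integrable.mono' (hb.integrableOn_Ioc (a := 0) (b := t)) (by fun_prop)
    (.of_forall fun u => ?_)
  rw [Real.norm_of_nonneg (by positivity)]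
  refine mul_le_mul_of_nonneg_left (Real.exp_le_exp.2 ?_) (by positivity)
  rw [neg_mul, ← mul_neg]
  exact mul_le_mul_of_nonneg_left (neg_chi_le hκ hε u) hc

lemma hasDerivAt_pow_mul_cexp_sq {f f' : ℝ → ℂ} (hf : ∀ s, HasDerivAt f (f' s) s) {r : ℝ}
    (hr : r ≠ 0) {n : ℕ} (hn : r ^ 2 = n) (u : ℝ) :
    HasDerivAt (fun u : ℝ => f (u / r) ^ n * Complex.exp ((u : ℂ) ^ 2 / 2))
      (r * (f (u / r) ^ (n - 1) * (f' (u / r) + (u / r : ℝ) * f (u / r)) *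
        Complex.exp ((u : ℂ) ^ 2 / 2))) u := by
  have hn0 : n ≠ 0 := by
    rintro rfl
    exact hr (by simpa using hn)
  have h1 := ((hf (u / r)).scomp u ((hasDerivAt_id u).div_const r)).pow n
  have h2 := ((((hasDerivAt_id u).ofReal_comp).pow 2).div_const 2).cexp
  refine HasDerivAt.congr_deriv (f := fun u : ℝ => f (u / r) ^ n *
    Complex.exp ((u : ℂ) ^ 2 / 2)) (h1.mul h2) ?_
  have hn' : (n : ℂ) = (r : ℂ) ^ 2 := by exact_mod_cast hn.symm
  have hr' : (r : ℂ) ≠ 0 := by exact_mod_cast hr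
  obtain ⟨m, rfl⟩ := Nat.exists_eq_succ_of_ne_zero hn0
  simp only [Function.comp_apply, id_eq, Complex.real_smul, hn', Nat.succ_sub_one, Pi.pow_apply,
    pow_succ]
  push_cast
  field_simp

lemma norm_pow_charFun_sub_le_of_nonneg {μ : Measure ℝ} [IsProbabilityMeasure μ]
    (hmean : ∫ x, x ∂μ = 0) (hvar : ∫ x, x ^ 2 ∂μ = 1)
    (h3 : Integrable (fun x => |x| ^ 3) μ) {θ₀ : ℝ}
    (hθ₀mem : θ₀ ∈ Set.Icc Real.pi (2 * Real.pi))
    (hθ₀root : θ₀ ^ 2 + 2 * θ₀ * Real.sin θ₀ + 6 * (Real.cos θ₀ - 1) = 0)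
    {n : ℕ} (hn : 1 ≤ n) {t : ℝ} (ht : 0 ≤ t) :
    ‖(∫ x, Complex.exp (Complex.I * (t / Real.sqrt n : ℝ) * x) ∂μ) ^ n -
        (Real.exp (-t ^ 2 / 2) : ℂ)‖ ≤
      (∫ x, |x| ^ 3 ∂μ) / Real.sqrt n * Real.exp (-t ^ 2 / 2) *
        ∫ u in (0 : ℝ)..t, u ^ 2 / 2 * Real.exp (u ^ 2 / 2) *
          Real.exp (-((n : ℝ) - 1) / n *
            chi θ₀ kappa u ((∫ x, |x| ^ 3 ∂μ) / Real.sqrt n + 1 / Real.sqrt n)) := by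
  have h1 := integrable_id_of_integrable_abs_cube h3
  have hβ : 0 ≤ ∫ x, |x| ^ 3 ∂μ := integral_nonneg fun x => by positivity
  set β := ∫ x, |x| ^ 3 ∂μ with hβdef
  have hn1 : (1 : ℝ) ≤ n := by exact_mod_cast hn
  have hn0 : (n : ℝ) ≠ 0 := by positivity
  set r := Real.sqrt n with hrdef
  have hr : 0 < r := Real.sqrt_pos.2 (by linarith)
  have hrn : r ^ 2 = n := Real.sq_sqrt (by linarith)
  let f : ℝ → ℂ := fun s => ∫ x, Complex.exp (Complex.I * s * x) ∂μ
  let f' : ℝ → ℂ := fun s => ∫ x, Complex.I * (x * Complex.exp (Complex.I * s * x)) ∂μ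
  have hf : ∀ s, HasDerivAt f (f' s) s := hasDerivAt_integral_cexp h1
  have hfc : Continuous f := continuous_iff_continuousAt.2 fun s => (hf s).continuousAt
  have hfc' : Continuous f' := continuous_integral_mul_cexp h1
  have hF := hasDerivAt_pow_mul_cexp_sq hf hr.ne' hrn
  have hFc : Continuous fun u : ℝ => r * (f (u / r) ^ (n - 1) *
      (f' (u / r) + (u / r : ℝ) * f (u / r)) * Complex.exp ((u : ℂ) ^ 2 / 2)) := by fun_prop
  have hFTC := intervalIntegral.integral_eq_sub_of_hasDerivAt (fun u _ => hF u)
    (hFc.intervalIntegrable 0 t)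
  have hf0 : f 0 = 1 := by simp [f]
  have hbound : ∀ u : ℝ, ‖r * (f (u / r) ^ (n - 1) * (f' (u / r) + (u / r : ℝ) * f (u / r)) *
      Complex.exp ((u : ℂ) ^ 2 / 2))‖ ≤ β / r * (u ^ 2 / 2 * Real.exp (u ^ 2 / 2) *
        Real.exp (-((n : ℝ) - 1) / n * chi θ₀ kappa u (β / r + 1 / r))) := by
    intro u
    have hpow : ‖f (u / r)‖ ^ (n - 1) ≤
        Real.exp (-((n : ℝ) - 1) / n * chi θ₀ kappa u (β / r + 1 / r)) := by
      refine (pow_le_pow_left₀ (norm_nonneg _) (norm_integral_cexp_le_exp_neg_chi hmean hvar h3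
        hθ₀mem hθ₀root (u / r)) (n - 1)).trans_eq ?_
      rw [← hβdef, ← Real.exp_nat_mul, ← add_div, chi_scale _ _ _ _ hr, hrn, Nat.cast_sub hn]
      congr 1
      push_cast
      field_simp
    have hder : ‖f' (u / r) + (u / r : ℝ) * f (u / r)‖ ≤ β * (u / r) ^ 2 / 2 :=
      norm_integral_deriv_add_le hmean hvar h3 (u / r)
    have hexp : ‖Complex.exp ((u : ℂ) ^ 2 / 2)‖ = Real.exp (u ^ 2 / 2) := by
      rw [Complex.norm_exp]
      norm_cast
    rw [norm_mul, norm_mul, norm_mul, norm_pow, hexp, Complex.norm_real,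
      Real.norm_of_nonneg hr.le]
    calc r * (‖f (u / r)‖ ^ (n - 1) * ‖f' (u / r) + (u / r : ℝ) * f (u / r)‖ *
          Real.exp (u ^ 2 / 2))
        ≤ r * (Real.exp (-((n : ℝ) - 1) / n * chi θ₀ kappa u (β / r + 1 / r)) *
          (β * (u / r) ^ 2 / 2) * Real.exp (u ^ 2 / 2)) := by gcongr
      _ = _ := by field_simp
  have hint : IntervalIntegrable (fun u => u ^ 2 / 2 * Real.exp (u ^ 2 / 2) *
      Real.exp (-((n : ℝ) - 1) / n * chi θ₀ kappa u (β / r + 1 / r))) volume 0 t := by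
    have h := intervalIntegrable_exp_neg_chi (θ₀ := θ₀) (c := ((n : ℝ) - 1) / n)
      (ε := β / r + 1 / r) kappa_nonneg (by positivity)
      (div_nonneg (by linarith) (by linarith)) ht
    simpa only [neg_div] using h
  have hnorm := intervalIntegral.norm_integral_le_of_norm_le ht
    (.of_forall fun u _ => hbound u) (hint.const_mul (β / r))
  rw [hFTC, intervalIntegral.integral_const_mul] at hnorm
  have hsplit : f (t / r) ^ n - (Real.exp (-t ^ 2 / 2) : ℂ) = (Real.exp (-t ^ 2 / 2) : ℂ) *
      (f (t / r) ^ n * Complex.exp ((t : ℂ) ^ 2 / 2) -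
        f (0 / r) ^ n * Complex.exp (((0 : ℝ) : ℂ) ^ 2 / 2)) := by
    have he : (Real.exp (-t ^ 2 / 2) : ℂ) * Complex.exp ((t : ℂ) ^ 2 / 2) = 1 := by
      push_cast
      rw [← Complex.exp_add, neg_div, neg_add_cancel, Complex.exp_zero]
    rw [zero_div, hf0]
    simp only [one_pow, Complex.ofReal_zero, ne_eq, OfNat.ofNat_ne_zero, not_false_eq_true,
      zero_pow, zero_div, Complex.exp_zero]
    linear_combination (-f (t / r) ^ n) * he
  change ‖f (t / r) ^ n - (Real.exp (-t ^ 2 / 2) : ℂ)‖ ≤ _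
  rw [hsplit, norm_mul, Complex.norm_real, Real.norm_of_nonneg (Real.exp_pos _).le]
  exact (mul_le_mul_of_nonneg_left hnorm (Real.exp_pos _).le).trans_eq (by ring)

lemma integral_cexp_neg (μ : Measure ℝ) (s : ℝ) :
    ∫ x, Complex.exp (Complex.I * (-s : ℝ) * x) ∂μ =
      (starRingEnd ℂ) (∫ x, Complex.exp (Complex.I * s * x) ∂μ) := by
  rw [← integral_conj]
  congr 1 with x
  rw [← Complex.exp_conj]
  simp

/-- The estimate `r₂`: for a distribution with zero mean, unit variance and third absolute
moment `β³`, with `ℓ = β³/√n` and `ℓ_n = ℓ + 1/√n`, the characteristic function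
`f_n(t) = (f(t/√n))ⁿ` of the normalized sum satisfies
`|f_n(t) − e^{−t²/2}| ≤ ℓ e^{−t²/2} ∫₀^{|t|} (u²/2) e^{u²/2} exp{−((n−1)/n)χ(u,ℓ_n)} du`. -/
theorem charFun_diff_bound_r2 (μ : Measure ℝ) [IsProbabilityMeasure μ]
    (hmean : ∫ x, x ∂μ = 0) (hvar : ∫ x, x ^ 2 ∂μ = 1)
    (hint3 : Integrable (fun x => |x| ^ 3) μ)
    (β3 : ℝ) (hβ3 : β3 = ∫ x, |x| ^ 3 ∂μ)
    (f : ℝ → ℂ) (hf : ∀ t : ℝ, f t = ∫ x, Complex.exp (Complex.I * t * x) ∂μ)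
    (θ₀ : ℝ) (hθ₀mem : θ₀ ∈ Set.Icc Real.pi (2 * Real.pi))
    (hθ₀root : θ₀ ^ 2 + 2 * θ₀ * Real.sin θ₀ + 6 * (Real.cos θ₀ - 1) = 0)
    (n : ℕ) (hn : 1 ≤ n) (t : ℝ) :
    ‖(f (t / Real.sqrt n)) ^ n - (Real.exp (-t ^ 2 / 2) : ℂ)‖ ≤
      β3 / Real.sqrt n * Real.exp (-t ^ 2 / 2) *
        ∫ u in (0 : ℝ)..|t|, u ^ 2 / 2 * Real.exp (u ^ 2 / 2) *
          Real.exp (-((n : ℝ) - 1) / n *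
            chi θ₀ kappa u (β3 / Real.sqrt n + 1 / Real.sqrt n)) := by
  subst hβ3
  obtain rfl : f = fun t : ℝ => ∫ x, Complex.exp (Complex.I * t * x) ∂μ := funext hf
  have key := norm_pow_charFun_sub_le_of_nonneg hmean hvar hint3 hθ₀mem hθ₀root hn (abs_nonneg t)
  rw [sq_abs] at key
  refine (le_of_eq ?_).trans key
  rcases abs_choice t with h | h
  · rw [h]
  · rw [h, neg_div (Real.sqrt n) t, integral_cexp_neg, ← Complex.norm_conj]
    simp only [map_sub, map_pow, Complex.conj_ofReal]
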